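/- arXiv:1706.09040 — 2 statements merged into one kernel-verified Lean document; each statement's English description precedes it below -/
import Mathlib

section
/- If the pair of functions φ, f : I → ℝ solves the functional equation φ((x+y)/2)(f(x)+f(y)) = φ(x)f(x) + φ(y)f(y) for all x, y ∈ I, φ is continuous on I, and φ is not constant on the set ½((cl̄ Z_f)^c + I), then f is nowhere zero on I and continuous, both φ and f are infinitely many times differentiable on I, φ is strictly monotone on I, and there exists a nonzero real constant λ such that φ'(x)·f(x)² = λ for all x ∈ I. -/
open Set Filter Topology

lemma Set.OrdConnected.midpoint_mem {I : Set ℝ} (hI : I.OrdConnected) {x y : ℝ} (hx : x ∈ I)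
    (hy : y ∈ I) : (x + y) / 2 ∈ I := by
  rcases le_total x y with h | h
  · exact hI.out hx hy ⟨by linarith, by linarith⟩
  · exact hI.out hy hx ⟨by linarith, by linarith⟩

lemma ContinuousOn.eq_const_of_mem_closure {I S : Set ℝ} {g : ℝ → ℝ} {c x : ℝ}
    (hg : ContinuousOn g I) (hSI : S ⊆ I) (hS : ∀ y ∈ S, g y = c) (hx : x ∈ I)
    (hxS : x ∈ closure S) : g x = c := by
  obtain ⟨s, hs, hlim⟩ := mem_closure_iff_seq_limit.1 hxS
  have h1 : Tendsto (fun n => g (s n)) atTop (𝓝 (g x)) :=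
    (hg x hx).tendsto.comp
      (tendsto_nhdsWithin_iff.2 ⟨hlim, Eventually.of_forall fun n => hSI (hs n)⟩)
  have h2 : (fun n => g (s n)) = fun _ => c := funext fun n => hS _ (hs n)
  rw [h2] at h1
  exact tendsto_nhds_unique tendsto_const_nhds h1 |>.symm

lemma continuousOn_comp_midpoint {I : Set ℝ} (hI : I.OrdConnected) {φ : ℝ → ℝ}
    (hφ : ContinuousOn φ I) {b : ℝ} (hb : b ∈ I) :
    ContinuousOn (fun y => φ ((b + y) / 2)) I :=
  hφ.comp (by fun_prop) fun _ hy => hI.midpoint_mem hb hy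

/-- If `φ` is constant under halving towards points of a closed set `K`, then it is determined
along any segment that meets `K` only at its endpoint `a`. -/
lemma eq_of_segment_notMem {I K : Set ℝ} (hI : I.OrdConnected) {φ : ℝ → ℝ}
    (hφ : ContinuousOn φ I)
    (hK : ∀ x ∈ I, x ∈ K → ∀ y ∈ I, y ∉ K → φ ((x + y) / 2) = φ y)
    {a b u : ℝ} (ha : a ∈ I) (haK : a ∈ K) (hb : b ∈ I) (hbK : b ∈ K) (hu : u ∈ I)
    (hseg : ∀ t ∈ Ioc (0 : ℝ) 1, a + t * (u - a) ∉ K) : φ ((b + a) / 2) = φ u := by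
  have hmem : ∀ t ∈ Ioc (0 : ℝ) 1, a + t * (u - a) ∈ I := fun t ht => by
    have := hI.convex.add_smul_sub_mem ha hu ⟨ht.1.le, ht.2⟩
    simpa using this
  have ht : ∀ n : ℕ, (1 / 2 : ℝ) ^ n ∈ Ioc (0 : ℝ) 1 := fun n =>
    ⟨by positivity, pow_le_one₀ (by norm_num) (by norm_num)⟩
  have hconst : ∀ n : ℕ, φ (a + (1 / 2 : ℝ) ^ n * (u - a)) = φ u := by
    intro n
    induction n with
    | zero => congr 1; ring
    | succ n ih =>
      rw [← ih, ← hK a ha haK _ (hmem _ (ht n)) (hseg _ (ht n))]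
      congr 1
      ring
  refine (continuousOn_comp_midpoint hI hφ hb).eq_const_of_mem_closure (c := φ u)
    (S := range fun n : ℕ => a + (1 / 2 : ℝ) ^ n * (u - a)) ?_ ?_ ha ?_
  · rintro _ ⟨n, rfl⟩
    exact hmem _ (ht n)
  · rintro _ ⟨n, rfl⟩
    exact (hK b hb hbK _ (hmem _ (ht n)) (hseg _ (ht n))).trans (hconst n)
  · refine mem_closure_of_tendsto (f := fun n : ℕ => a + (1 / 2 : ℝ) ^ n * (u - a)) (b := atTop)
      ?_ (Eventually.of_forall fun n => mem_range_self n)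
    have := ((tendsto_pow_atTop_nhds_zero_of_lt_one (r := (1 / 2 : ℝ))
      (by norm_num) (by norm_num)).mul_const (u - a)).const_add a
    simpa using this

/-- Under the hypotheses of `eq_of_segment_notMem`, `φ` is constant off a nonempty closed `K`. -/
lemma eq_of_notMem {I K : Set ℝ} (hI : I.OrdConnected) (hKc : IsClosed K) {φ : ℝ → ℝ}
    (hφ : ContinuousOn φ I)
    (hK : ∀ x ∈ I, x ∈ K → ∀ y ∈ I, y ∉ K → φ ((x + y) / 2) = φ y)
    {z u v : ℝ} (hz : z ∈ I) (hzK : z ∈ K) (hu : u ∈ I) (huK : u ∉ K) (hv : v ∈ I)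
    (hvK : v ∉ K) : φ u = φ v := by
  wlog huv : u ≤ v generalizing u v
  · exact (this hv hvK hu huK (le_of_not_ge huv)).symm
  by_cases hne : (K ∩ Icc u v).Nonempty
  · have hcomp : IsCompact (K ∩ Icc u v) := isCompact_Icc.inter_left hKc
    obtain ⟨b, ⟨hbK, hub, hbv⟩, hb⟩ := hcomp.exists_isLeast hne
    obtain ⟨c, ⟨hcK, huc, hcv⟩, hc⟩ := hcomp.exists_isGreatest hne
    have hbI : b ∈ I := hI.out hu hv ⟨hub, hbv⟩
    have hcI : c ∈ I := hI.out hu hv ⟨huc, hcv⟩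
    have hub' : u < b := lt_of_le_of_ne hub fun h => huK (h ▸ hbK)
    have hcv' : c < v := lt_of_le_of_ne hcv fun h => hvK (h ▸ hcK)
    rw [← eq_of_segment_notMem hI hφ hK hbI hbK hcI hcK hu,
      ← eq_of_segment_notMem hI hφ hK hcI hcK hbI hbK hv, add_comm]
    · intro t ht h
      have := hc ⟨h, by nlinarith [ht.1, ht.2], by nlinarith [ht.1, ht.2]⟩
      nlinarith [ht.1, ht.2]
    · intro t ht h
      have := hb ⟨h, by nlinarith [ht.1, ht.2], by nlinarith [ht.1, ht.2]⟩
      nlinarith [ht.1, ht.2]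
  · have hno : ∀ x ∈ Icc u v, x ∉ K := fun x hx hxK => hne ⟨x, hxK, hx⟩
    rcases lt_or_ge z u with hzu | hzu
    · obtain ⟨a, ⟨haK, hza, hau⟩, ha⟩ :=
        (isCompact_Icc.inter_left hKc).exists_isGreatest (s := K ∩ Icc z u)
          ⟨z, hzK, le_rfl, hzu.le⟩
      have haI : a ∈ I := hI.out hz hu ⟨hza, hau⟩
      have hau' : a < u := lt_of_le_of_ne hau fun h => huK (h ▸ haK)
      have hgap : ∀ x, a < x → x ≤ v → x ∉ K := fun x hax hxv hxK => by
        rcases le_total x u with h | h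
        · exact absurd (ha ⟨hxK, by linarith, h⟩) (not_le.2 hax)
        · exact hno x ⟨h, hxv⟩ hxK
      rw [← eq_of_segment_notMem hI hφ hK haI haK haI haK hu,
        ← eq_of_segment_notMem hI hφ hK haI haK haI haK hv]
      · exact fun t ht => hgap _ (by nlinarith [ht.1, ht.2]) (by nlinarith [ht.1, ht.2])
      · exact fun t ht => hgap _ (by nlinarith [ht.1, ht.2]) (by nlinarith [ht.1, ht.2])
    · have hvz : v < z := not_le.1 fun h => hno z ⟨hzu, h⟩ hzK
      obtain ⟨a, ⟨haK, hva, haz⟩, ha⟩ :=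
        (isCompact_Icc.inter_left hKc).exists_isLeast (s := K ∩ Icc v z)
          ⟨z, hzK, hvz.le, le_rfl⟩
      have haI : a ∈ I := hI.out hv hz ⟨hva, haz⟩
      have hva' : v < a := lt_of_le_of_ne hva fun h => hvK (h ▸ haK)
      have hgap : ∀ x, x < a → u ≤ x → x ∉ K := fun x hax hxv hxK => by
        rcases le_total v x with h | h
        · exact absurd (ha ⟨hxK, h, by linarith⟩) (not_le.2 hax)
        · exact hno x ⟨hxv, h⟩ hxK
      rw [← eq_of_segment_notMem hI hφ hK haI haK haI haK hu,
        ← eq_of_segment_notMem hI hφ hK haI haK haI haK hv]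
      · exact fun t ht => hgap _ (by nlinarith [ht.1, ht.2]) (by nlinarith [ht.1, ht.2])
      · exact fun t ht => hgap _ (by nlinarith [ht.1, ht.2]) (by nlinarith [ht.1, ht.2])

/-- Under the hypotheses of `eq_of_notMem`, `φ` is constant on `½((I \ K) + I)`. -/
lemma eq_midpoint_of_notMem {I K : Set ℝ} (hIo : IsOpen I) (hI : I.OrdConnected)
    (hKc : IsClosed K) {φ : ℝ → ℝ} (hφ : ContinuousOn φ I)
    (hK : ∀ x ∈ I, x ∈ K → ∀ y ∈ I, y ∉ K → φ ((x + y) / 2) = φ y) {c : ℝ}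
    (hc : ∀ y ∈ I \ K, φ y = c) {u v : ℝ} (hu : u ∈ I \ K) (hv : v ∈ I) :
    φ ((u + v) / 2) = c := by
  by_cases hvK : v ∈ K
  · rw [add_comm, hK v hv hvK u hu.1 hu.2, hc u hu]
  have hUo : IsOpen (I \ K) := hIo.sdiff hKc
  replace hv : v ∈ I \ K := ⟨hv, hvK⟩
  wlog huv : u ≤ v generalizing u v
  · rw [add_comm]
    exact this hv hu.2 hu (le_of_not_ge huv)
  have hmI : (u + v) / 2 ∈ I := hI.midpoint_mem hu.1 hv.1
  by_cases hm : (u + v) / 2 ∈ closure (I \ K)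
  · exact hφ.eq_const_of_mem_closure sdiff_subset hc hmI hm
  set m := (u + v) / 2 with hm_def
  have hlim : ∀ w ∈ I, w ∉ I \ K → ∀ p ∈ I, p ∈ closure (I \ K) → φ ((w + p) / 2) = c := by
    intro w hw hwU p hp hpU
    have hwK : w ∈ K := by_contra fun h => hwU ⟨hw, h⟩
    exact (continuousOn_comp_midpoint hI hφ hw).eq_const_of_mem_closure sdiff_subset
      (fun y hy => (hK w hw hwK y hy.1 hy.2).trans (hc y hy)) hp hpU
  obtain ⟨p, ⟨hpU, hup, hpm⟩, hp⟩ :=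
    (isCompact_Icc.inter_left isClosed_closure).exists_isGreatest
      (s := closure (I \ K) ∩ Icc u m) ⟨u, subset_closure hu, le_rfl, by linarith⟩
  obtain ⟨q, ⟨hqU, hmq, hqv⟩, hq⟩ :=
    (isCompact_Icc.inter_left isClosed_closure).exists_isLeast
      (s := closure (I \ K) ∩ Icc m v) ⟨v, subset_closure hv, by linarith, le_rfl⟩
  have hpm' : p < m := lt_of_le_of_ne hpm fun h => hm (h ▸ hpU)
  have hmq' : m < q := lt_of_le_of_ne hmq fun h => hm (h ▸ hqU)
  have hgap : ∀ x, p < x → x < q → x ∉ closure (I \ K) := fun x hpx hxq hx => by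
    rcases le_total x m with h | h
    · exact absurd (hp ⟨hx, by linarith, h⟩) (not_le.2 hpx)
    · exact absurd (hq ⟨hx, h, by linarith⟩) (not_le.2 hxq)
  have hsub : Icc p q ⊆ (I \ K)ᶜ := by
    have h1 : Ioo p q ⊆ (I \ K)ᶜ := fun x hx hxU => hgap x hx.1 hx.2 (subset_closure hxU)
    have h2 := closure_minimal h1 hUo.isClosed_compl
    rwa [closure_Ioo (by linarith)] at h2
  have hpI : p ∈ I := hI.out hu.1 hv.1 ⟨hup, by linarith⟩
  have hqI : q ∈ I := hI.out hu.1 hv.1 ⟨by linarith, hqv⟩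
  rcases le_total (m - p) (q - m) with h | h
  · have := hlim (2 * m - p) (hI.out hpI hqI ⟨by linarith, by linarith⟩)
      (hsub ⟨by linarith, by linarith⟩) p hpI hpU
    rwa [show (2 * m - p + p) / 2 = m by ring] at this
  · have := hlim (2 * m - q) (hI.out hpI hqI ⟨by linarith, by linarith⟩)
      (hsub ⟨by linarith, by linarith⟩) q hqI hqU
    rwa [show (2 * m - q + q) / 2 = m by ring] at this

lemma ne_zero_of_not_const {I : Set ℝ} (hIo : IsOpen I) (hI : I.OrdConnected) {φ f : ℝ → ℝ}
    (heq : ∀ x ∈ I, ∀ y ∈ I, φ ((x + y) / 2) * (f x + f y) = φ x * f x + φ y * f y)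
    (hφ : ContinuousOn φ I)
    (hnc : ¬ ∃ c : ℝ, ∀ u ∈ I \ closure {z ∈ I | f z = 0}, ∀ v ∈ I, φ ((u + v) / 2) = c) :
    ∀ x ∈ I, f x ≠ 0 := by
  intro z hz hfz
  apply hnc
  set K := closure {z ∈ I | f z = 0} with hKdef
  have hK : ∀ x ∈ I, x ∈ K → ∀ y ∈ I, y ∉ K → φ ((x + y) / 2) = φ y := by
    intro x hx hxK y hy hyK
    have hfy : f y ≠ 0 := fun h => hyK (subset_closure ⟨hy, h⟩)
    rw [add_comm]
    refine (continuousOn_comp_midpoint hI hφ hy).eq_const_of_mem_closure (c := φ y)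
      (sep_subset I _) ?_ hx hxK
    rintro w ⟨hw, hfw⟩
    have := heq y hy w hw
    rw [hfw, add_zero, mul_zero, add_zero] at this
    exact mul_right_cancel₀ hfy this
  have hzK : z ∈ K := subset_closure ⟨hz, hfz⟩
  rcases (I \ K).eq_empty_or_nonempty with he | ⟨u₀, hu₀⟩
  · exact ⟨0, fun u hu => by simp [he] at hu⟩
  · refine ⟨φ u₀, fun u hu v hv => eq_midpoint_of_notMem hIo hI isClosed_closure hφ hK
      (fun y hy => ?_) hu hv⟩
    exact eq_of_notMem hI isClosed_closure hφ hK hz hzK hy.1 hy.2 hu₀.1 hu₀.2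

/-- A function whose level sets are closed under reflection about their points is constant as
soon as it is constant on an open subinterval. -/
lemma eq_of_eq_on_ball {I : Set ℝ} (hI : I.OrdConnected) {φ : ℝ → ℝ}
    (hsymm : ∀ x ∈ I, ∀ y ∈ I, φ x = φ ((x + y) / 2) → φ y = φ ((x + y) / 2))
    {m δ c : ℝ} (hm : m ∈ I) (hδ : 0 < δ) (hball : ∀ x ∈ I, |x - m| < δ → φ x = c) :
    ∀ x ∈ I, φ x = c := by
  have key : ∀ n : ℕ, ∀ x ∈ I, |x - m| < (3 / 2) ^ n * δ → φ x = c := by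
    intro n
    induction n with
    | zero => simpa using hball
    | succ n ih =>
      intro x hx hxm
      have hseg : ∀ t ∈ Icc (0 : ℝ) 1, m + t * (x - m) ∈ I := fun t ht => by
        simpa using hI.convex.add_smul_sub_mem hm hx ht
      have hthird := hseg (1 / 3) ⟨by norm_num, by norm_num⟩
      have htwo := hseg (2 / 3) ⟨by norm_num, by norm_num⟩
      have hmid : (m + 1 / 3 * (x - m) + x) / 2 = m + 2 / 3 * (x - m) := by ring
      have h1 : φ (m + 1 / 3 * (x - m)) = c := by
        refine ih _ hthird ?_
        rw [add_sub_cancel_left, abs_mul, abs_of_pos (by norm_num : (0 : ℝ) < 1 / 3)]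
        rw [pow_succ] at hxm
        nlinarith [abs_nonneg (x - m)]
      have h2 : φ (m + 2 / 3 * (x - m)) = c := by
        refine ih _ htwo ?_
        rw [add_sub_cancel_left, abs_mul, abs_of_pos (by norm_num : (0 : ℝ) < 2 / 3)]
        rw [pow_succ] at hxm
        nlinarith [abs_nonneg (x - m)]
      have := hsymm _ hthird x hx (by rw [hmid, h1, h2])
      rwa [hmid, h2] at this
  intro x hx
  obtain ⟨n, hn⟩ := pow_unbounded_of_one_lt (|x - m| / δ) (by norm_num : (1 : ℝ) < 3 / 2)
  exact key n x hx ((div_lt_iff₀ hδ).1 hn)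

lemma exists_midpoint_ne {I : Set ℝ} (hIo : IsOpen I) (hI : I.OrdConnected) {φ f : ℝ → ℝ}
    (heq : ∀ x ∈ I, ∀ y ∈ I, φ ((x + y) / 2) * (f x + f y) = φ x * f x + φ y * f y)
    (hf : ∀ x ∈ I, f x ≠ 0) (hnc : ¬ ∃ c : ℝ, ∀ x ∈ I, φ x = c) {x : ℝ} (hx : x ∈ I) :
    ∃ y ∈ I, φ ((x + y) / 2) ≠ φ x := by
  by_contra! h
  obtain ⟨ε, hε, hball⟩ := Metric.isOpen_iff.1 hIo x hx
  refine hnc ⟨φ x, eq_of_eq_on_ball hI (fun a ha b hb hab => ?_) hx (half_pos hε)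
    fun w _ hwx => ?_⟩
  · have := heq a ha b hb
    exact (mul_right_cancel₀ (hf b hb) (by rw [hab] at this; linarith)).symm
  · have := h (2 * w - x) (hball (by
      rw [Metric.mem_ball, Real.dist_eq, show 2 * w - x - x = 2 * (w - x) by ring, abs_mul,
        abs_two]
      linarith))
    rwa [show (x + (2 * w - x)) / 2 = w by ring] at this

lemma contDiffOn_of_contDiffOn_mean {I : Set ℝ} (hIo : IsOpen I) (hI : I.OrdConnected)
    {φ f : ℝ → ℝ}
    (heq : ∀ x ∈ I, ∀ y ∈ I, φ ((x + y) / 2) * (f x + f y) = φ x * f x + φ y * f y)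
    (hf : ∀ x ∈ I, f x ≠ 0) (hnc : ¬ ∃ c : ℝ, ∀ x ∈ I, φ x = c) {n : ℕ}
    (hφ : ContDiffOn ℝ n φ I) : ContDiffOn ℝ n f I := by
  intro x hx
  obtain ⟨y, hy, hne⟩ := exists_midpoint_ne hIo hI heq hf hnc hx
  have hmid : ContDiffOn ℝ n (fun w => φ ((w + y) / 2)) I :=
    hφ.comp (by fun_prop) fun _ hw => hI.midpoint_mem hw hy
  have hden : ContDiffOn ℝ n (fun w => φ ((w + y) / 2) - φ w) I := hmid.sub hφ
  have hquot : ContDiffWithinAt ℝ n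
      (fun w => (φ y - φ ((w + y) / 2)) * f y / (φ ((w + y) / 2) - φ w)) I x :=
    (((contDiffOn_const.sub hmid).mul contDiffOn_const) x hx).div (hden x hx)
      (sub_ne_zero.2 hne)
  refine hquot.congr_of_eventuallyEq_of_mem ?_ hx
  filter_upwards [(hden.continuousOn x hx).eventually_ne (sub_ne_zero.2 hne),
    self_mem_nhdsWithin] with w hw hwI
  rw [eq_div_iff hw]
  linarith [heq w hwI y hy]

lemma hasDerivAt_integral_of_mem {I : Set ℝ} (hIo : IsOpen I) (hI : I.OrdConnected)
    {f : ℝ → ℝ} (hf : ContinuousOn f I) {a x : ℝ} (ha : a ∈ I) (hx : x ∈ I) :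
    HasDerivAt (fun u => ∫ t in a..u, f t) (f x) x :=
  intervalIntegral.integral_hasDerivAt_right
    ((hf.mono (hI.uIcc_subset ha hx)).intervalIntegrable)
    (hf.stronglyMeasurableAtFilter hIo x hx) (hf.continuousAt (hIo.mem_nhds hx))

lemma ContDiffOn.integral_right {I : Set ℝ} (hIo : IsOpen I) (hI : I.OrdConnected)
    {f : ℝ → ℝ} {n : ℕ} (hf : ContDiffOn ℝ n f I) {a : ℝ} (ha : a ∈ I) :
    ContDiffOn ℝ (n + 1 : ℕ) (fun u => ∫ t in a..u, f t) I := by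
  have hd := fun x hx => hasDerivAt_integral_of_mem hIo hI hf.continuousOn ha (x := x) hx
  push_cast
  rw [contDiffOn_succ_iff_deriv_of_isOpen hIo]
  exact ⟨fun x hx => (hd x hx).differentiableAt.differentiableWithinAt, by simp,
    hf.congr fun x hx => (hd x hx).deriv⟩

lemma contDiffOn_mean_succ {I : Set ℝ} (hIo : IsOpen I) (hI : I.OrdConnected)
    {φ f : ℝ → ℝ}
    (heq : ∀ x ∈ I, ∀ y ∈ I, φ ((x + y) / 2) * (f x + f y) = φ x * f x + φ y * f y)
    (hf : ∀ x ∈ I, f x ≠ 0) {n : ℕ} (hφn : ContDiffOn ℝ n φ I) (hfn : ContDiffOn ℝ n f I) :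
    ContDiffOn ℝ (n + 1 : ℕ) φ I := by
  intro a ha
  obtain ⟨ε, hε, hball⟩ := Metric.isOpen_iff.1 hIo a ha
  have hgn : ContDiffOn ℝ n (fun x => φ x * f x) I := hφn.mul hfn
  set F : ℝ → ℝ := fun u => ∫ t in a..u, f t with hF
  set G : ℝ → ℝ := fun u => ∫ t in a..u, φ t * f t with hG
  set h := ε / 2 with hh
  have hshift : ∀ w ∈ Metric.ball a h, ∀ s ∈ Icc (w - h) (w + h), s ∈ I := by
    intro w hw s hs
    apply hball
    rw [Metric.mem_ball, Real.dist_eq, abs_lt] at hw ⊢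
    constructor <;> linarith [hw.1, hw.2, hs.1, hs.2]
  have hhpos : 0 < h := half_pos hε
  have hdiff : ∀ {k : ℝ → ℝ}, ContDiffOn ℝ n k I → ContDiffAt ℝ (n + 1 : ℕ)
      (fun w => (∫ t in a..(w + h), k t) - ∫ t in a..(w - h), k t) a := by
    intro k hk
    have hI' := hk.integral_right hIo hI ha
    have ha' := Metric.mem_ball_self (x := a) hhpos
    have h1 := hI'.contDiffAt (hIo.mem_nhds (hshift a ha' (a + h) ⟨by linarith, le_rfl⟩))
    have h2 := hI'.contDiffAt (hIo.mem_nhds (hshift a ha' (a - h) ⟨le_rfl, by linarith⟩))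
    exact (h1.comp a (contDiffAt_id.add contDiffAt_const)).sub
      (h2.comp a (contDiffAt_id.sub contDiffAt_const))
  have hne : ∀ w ∈ Metric.ball a h, F (w + h) - F (w - h) ≠ 0 := by
    intro w hw
    have hd := fun x hx => hasDerivAt_integral_of_mem hIo hI hfn.continuousOn ha (x := x) hx
    obtain ⟨c, hc, hslope⟩ := exists_hasDerivAt_eq_slope F f (by linarith : w - h < w + h)
      (fun x hx => (hd x (hshift w hw x hx)).continuousAt.continuousWithinAt)
      (fun x hx => hd x (hshift w hw x (Ioo_subset_Icc_self hx)))
    intro h0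
    rw [h0, zero_div] at hslope
    exact hf c (hshift w hw c (Ioo_subset_Icc_self hc)) hslope
  have hmean : ∀ w ∈ Metric.ball a h,
      φ w * (F (w + h) - F (w - h)) = G (w + h) - G (w - h) := by
    intro w hw
    have hL := hshift w hw (w - h) ⟨le_rfl, by linarith⟩
    have hR := hshift w hw (w + h) ⟨by linarith, le_rfl⟩
    have hint : ∀ {k : ℝ → ℝ}, ContDiffOn ℝ n k I → ∀ {p q : ℝ}, p ∈ I → q ∈ I →
        IntervalIntegrable k MeasureTheory.volume p q := fun hk _ _ hp hq =>
      (hk.continuousOn.mono (hI.uIcc_subset hp hq)).intervalIntegrable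
    rw [hF, hG]
    simp only
    rw [intervalIntegral.integral_interval_sub_left (hint hfn ha hR) (hint hfn ha hL),
      intervalIntegral.integral_interval_sub_left (hint hgn ha hR) (hint hgn ha hL),
      ← intervalIntegral.integral_const_mul, ← sub_eq_zero,
      ← intervalIntegral.integral_sub ((hint hfn hL hR).const_mul _) (hint hgn hL hR)]
    have hrefl := intervalIntegral.integral_comp_sub_left (a := w - h) (b := w + h)
      (fun s => φ w * f s - φ s * f s) (2 * w)
    rw [show 2 * w - (w + h) = w - h by ring, show 2 * w - (w - h) = w + h by ring] at hrefl
    have hodd : ∫ s in (w - h)..(w + h), (φ w * f (2 * w - s) - φ (2 * w - s) * f (2 * w - s))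
        = ∫ s in (w - h)..(w + h), -(φ w * f s - φ s * f s) := by
      refine intervalIntegral.integral_congr fun s hs => ?_
      rw [uIcc_of_le (by linarith)] at hs
      have := heq s (hshift w hw s hs) (2 * w - s)
        (hshift w hw _ ⟨by linarith [hs.2], by linarith [hs.1]⟩)
      rw [show (s + (2 * w - s)) / 2 = w by ring] at this
      linarith
    rw [intervalIntegral.integral_neg] at hodd
    linarith
  refine ContDiffAt.contDiffWithinAt ?_
  refine ((hdiff hgn).div (hdiff hfn) (hne a (Metric.mem_ball_self hhpos))).congr_of_eventuallyEq
    ?_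
  filter_upwards [Metric.ball_mem_nhds a hhpos] with w hw
  exact (eq_div_iff (hne w hw)).2 (hmean w hw)

lemma contDiffOn_mean {I : Set ℝ} (hIo : IsOpen I) (hI : I.OrdConnected) {φ f : ℝ → ℝ}
    (heq : ∀ x ∈ I, ∀ y ∈ I, φ ((x + y) / 2) * (f x + f y) = φ x * f x + φ y * f y)
    (hφ : ContinuousOn φ I) (hf : ∀ x ∈ I, f x ≠ 0) (hnc : ¬ ∃ c : ℝ, ∀ x ∈ I, φ x = c)
    (n : ℕ) : ContDiffOn ℝ n φ I := by
  induction n with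
  | zero => exact contDiffOn_zero.2 hφ
  | succ n ih =>
    exact contDiffOn_mean_succ hIo hI heq hf ih
      (contDiffOn_of_contDiffOn_mean hIo hI heq hf hnc ih)

lemma deriv_deriv_mul_add_eq_zero {I : Set ℝ} (hIo : IsOpen I) (hI : I.OrdConnected)
    {φ f : ℝ → ℝ}
    (heq : ∀ x ∈ I, ∀ y ∈ I, φ ((x + y) / 2) * (f x + f y) = φ x * f x + φ y * f y)
    (hφ : ∀ x ∈ I, HasDerivAt φ (deriv φ x) x)
    (hφ' : ∀ x ∈ I, HasDerivAt (deriv φ) (deriv (deriv φ) x) x)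
    (hf : ∀ x ∈ I, HasDerivAt f (deriv f x) x) {x : ℝ} (hx : x ∈ I) :
    deriv (deriv φ) x * f x + 2 * deriv φ x * deriv f x = 0 := by
  have hfirst : ∀ y ∈ I, deriv φ ((x + y) / 2) * (1 / 2) * (f x + f y)
      + φ ((x + y) / 2) * deriv f x = deriv φ x * f x + φ x * deriv f x := by
    intro y hy
    have hm : HasDerivAt (fun w : ℝ => (w + y) / 2) (1 / 2) x :=
      ((hasDerivAt_id x).add_const y).div_const 2
    have hl := ((hφ _ (hI.midpoint_mem hx hy)).comp x hm).mul ((hf x hx).add_const (f y))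
    have hr := ((hφ x hx).mul (hf x hx)).add_const (φ y * f y)
    refine hl.unique (hr.congr_of_eventuallyEq ?_)
    filter_upwards [hIo.mem_nhds hx] with w hw
    exact heq w hw y hy
  have hmid : (x + x) / 2 = x := by ring
  have hm : HasDerivAt (fun w : ℝ => (x + w) / 2) (1 / 2) x :=
    ((hasDerivAt_id x).const_add x).div_const 2
  have hmI := hI.midpoint_mem hx hx
  have hl := ((((hφ' _ hmI).comp x hm).mul_const (1 / 2)).mul
    ((hf x hx).const_add (f x))).add (((hφ _ hmI).comp x hm).mul_const (deriv f x))
  have h0 := hl.unique ((hasDerivAt_const x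
    (deriv φ x * f x + φ x * deriv f x)).congr_of_eventuallyEq (by
      filter_upwards [hIo.mem_nhds hx] with w hw using hfirst w hw))
  simp only [Function.comp, hmid] at h0
  linarith


/-- If the pair of functions `φ, f : I → ℝ` solves the functional equation
`φ((x+y)/2)(f(x)+f(y)) = φ(x)f(x) + φ(y)f(y)` for all `x, y ∈ I`, `φ` is continuous on `I`,
and `φ` is not constant on the set `½((cl̄ Z_f)^c + I)`, then `f` is nowhere zero on `I` and
continuous, both `φ` and `f` are infinitely many times differentiable on `I`, `φ` is strictly
monotone on `I`, and there exists a nonzero real constant `λ` such that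
`φ'(x)·f(x)² = λ` for all `x ∈ I`. -/
theorem stmt6 (I : Set ℝ) (hIopen : IsOpen I) (hIconn : I.OrdConnected)
    (hIne : I.Nonempty) (φ f : ℝ → ℝ)
    (heq : ∀ x ∈ I, ∀ y ∈ I,
      φ ((x + y) / 2) * (f x + f y) = φ x * f x + φ y * f y)
    (hφ : ContinuousOn φ I)
    (hnc : ¬ ∃ c : ℝ, ∀ u ∈ I \ closure {z ∈ I | f z = 0}, ∀ v ∈ I,
      φ ((u + v) / 2) = c) :
    (∀ x ∈ I, f x ≠ 0) ∧ ContinuousOn f I ∧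
    ContDiffOn ℝ (⊤ : ℕ∞) φ I ∧ ContDiffOn ℝ (⊤ : ℕ∞) f I ∧
    (StrictMonoOn φ I ∨ StrictAntiOn φ I) ∧
    ∃ l : ℝ, l ≠ 0 ∧ ∀ x ∈ I, deriv φ x * (f x) ^ 2 = l := by
  have hf := ne_zero_of_not_const hIopen hIconn heq hφ hnc
  have hnc' : ¬ ∃ c : ℝ, ∀ x ∈ I, φ x = c := fun ⟨c, hc⟩ =>
    hnc ⟨c, fun u hu v hv => hc _ (hIconn.midpoint_mem hu.1 hv)⟩
  have hφn := contDiffOn_mean hIopen hIconn heq hφ hf hnc'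
  have hfn := fun n => contDiffOn_of_contDiffOn_mean hIopen hIconn heq hf hnc' (hφn n)
  have hφd : DifferentiableOn ℝ φ I := (hφn 1).differentiableOn (by simp)
  have hfd : DifferentiableOn ℝ f I := (hfn 1).differentiableOn (by simp)
  have hφd' : DifferentiableOn ℝ (deriv φ) I :=
    ((hφn 2).deriv_of_isOpen (m := 1) hIopen (by norm_num)).differentiableOn (by simp)
  have hd : ∀ {k : ℝ → ℝ}, DifferentiableOn ℝ k I → ∀ x ∈ I, HasDerivAt k (deriv k x) x :=
    fun hk x hx => (hk.differentiableAt (hIopen.mem_nhds hx)).hasDerivAt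
  have hprod : ∀ x ∈ I, HasDerivAt (fun x => deriv φ x * f x ^ 2) 0 x := by
    intro x hx
    have := deriv_deriv_mul_add_eq_zero hIopen hIconn heq (hd hφd) (hd hφd') (hd hfd) hx
    refine ((hd hφd' x hx).mul ((hd hfd x hx).pow 2)).congr_deriv ?_
    simp only [Pi.pow_apply]
    push_cast
    linear_combination (f x) * this
  obtain ⟨l, hl⟩ := hIopen.exists_is_const_of_deriv_eq_zero hIconn.isPreconnected
    (fun x hx => (hprod x hx).differentiableAt.differentiableWithinAt)
    (fun x hx => (hprod x hx).deriv)
  have hsq : ∀ x ∈ I, 0 < f x ^ 2 := fun x hx => by have := hf x hx; positivity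
  have hl0 : l ≠ 0 := by
    rintro rfl
    refine hnc' (hIopen.exists_is_const_of_deriv_eq_zero hIconn.isPreconnected hφd
      fun x hx => ?_)
    exact (mul_eq_zero.1 (hl x hx)).resolve_right (hsq x hx).ne'
  refine ⟨hf, hfd.continuousOn, contDiffOn_infty.2 hφn, contDiffOn_infty.2 hfn, ?_, l, hl0, hl⟩
  rcases hl0.lt_or_gt with h | h
  · refine Or.inr (strictAntiOn_of_deriv_neg hIconn.convex hφ fun x hx => ?_)
    have hx := interior_subset hx
    exact neg_of_mul_neg_left ((hl x hx).trans_lt h) (hsq x hx).le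
  · refine Or.inl (strictMonoOn_of_deriv_pos hIconn.convex hφ fun x hx => ?_)
    have hx := interior_subset hx
    exact pos_of_mul_pos_left ((hl x hx).symm ▸ h) (hsq x hx).le
end

section
/- Let φ, f : I → ℝ be such that φ is continuous and Z_f^c ⊆ cl(conv((cl̄ Z_f)^c)). Then (φ, f) solves the functional equation φ((x+y)/2)(f(x)+f(y)) = φ(x)f(x) + φ(y)f(y) for all x, y ∈ I if and only if either (a) there exists an interval J ⊆ I such that f(x) = 0 for all x ∈ I \ J and φ is constant on ½(J + I); or (b) there exist constants a, b, c, d, γ ∈ ℝ with ad ≠ bc such that for all x ∈ I one of the following holds: (1) γ < 0, f(x) = a·sin(√(−γ)x) + b·cos(√(−γ)x) ≠ 0 and φ(x) = (c·sin(√(−γ)x) + d·cos(√(−γ)x))/(a·sin(√(−γ)x) + b·cos(√(−γ)x)); (2) γ = 0, f(x) = a + bx ≠ 0 and φ(x) = (c + dx)/(a + bx); (3) γ > 0, f(x) = a·sinh(√γ x) + b·cosh(√γ x) ≠ 0 and φ(x) = (c·sinh(√γ x) + d·cosh(√γ x))/(a·sinh(√γ x) + b·cosh(√γ x)). -/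
open Set Filter Topology

/-- The functional equation `φ((x+y)/2)(f(x)+f(y)) = φ(x)f(x) + φ(y)f(y)` on the set `s`. -/
def SolvesMidpointEq (φ f : ℝ → ℝ) (s : Set ℝ) : Prop :=
  ∀ x ∈ s, ∀ y ∈ s, φ ((x + y) / 2) * (f x + f y) = φ x * f x + φ y * f y

/-- `S` and `C` generalize sine and cosine: the derivative of `S` is `C`, that of `C` is `γ S`, and
`C² - γ S² = 1`. -/
structure IsSinCosPair (γ : ℝ) (S C : ℝ → ℝ) : Prop where
  hasDerivAt_sin : ∀ x, HasDerivAt S (C x) x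
  hasDerivAt_cos : ∀ x, HasDerivAt C (γ * S x) x
  sq_sub_sq : ∀ x, C x ^ 2 - γ * S x ^ 2 = 1

section Calculus

lemma exists_eq_const_of_hasDerivAt_zero {U : Set ℝ} (hU : IsOpen U) (hUc : U.OrdConnected)
    {u : ℝ → ℝ} (h : ∀ x ∈ U, HasDerivAt u 0 x) : ∃ k, ∀ x ∈ U, u x = k :=
  hU.exists_is_const_of_deriv_eq_zero hUc.isPreconnected
    (fun x hx => (h x hx).differentiableAt.differentiableWithinAt) fun x hx => (h x hx).deriv

lemma exists_primitive {U : Set ℝ} (hU : IsOpen U) (hUc : U.OrdConnected) {u : ℝ → ℝ}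
    (hu : ContinuousOn u U) : ∃ F : ℝ → ℝ, ∀ x ∈ U, HasDerivAt F (u x) x := by
  rcases U.eq_empty_or_nonempty with rfl | ⟨x₀, hx₀⟩
  · exact ⟨u, by simp⟩
  refine ⟨fun t => ∫ s in x₀..t, u s, fun x hx => ?_⟩
  refine intervalIntegral.integral_hasDerivAt_right
    (hu.mono (hUc.uIcc_subset hx₀ hx)).intervalIntegrable
    (hu.stronglyMeasurableAtFilter hU x hx) (hu.continuousAt (hU.mem_nhds hx))

lemma ContDiffOn.exists_hasDerivAt {U : Set ℝ} (hU : IsOpen U) {n : ℕ} {u : ℝ → ℝ}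
    (hu : ContDiffOn ℝ (n + 1 : ℕ) u U) :
    ∃ u' : ℝ → ℝ, (∀ x ∈ U, HasDerivAt u (u' x) x) ∧ ContDiffOn ℝ n u' U := by
  push_cast at hu
  obtain ⟨h1, -, h2⟩ := (contDiffOn_succ_iff_deriv_of_isOpen hU).1 hu
  exact ⟨deriv u, fun x hx => (h1.differentiableAt (hU.mem_nhds hx)).hasDerivAt, h2⟩

lemma contDiffOn_succ_of_hasDerivAt {U : Set ℝ} (hU : IsOpen U) {n : ℕ} {u u' : ℝ → ℝ}
    (h : ∀ x ∈ U, HasDerivAt u (u' x) x) (hu' : ContDiffOn ℝ n u' U) :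
    ContDiffOn ℝ (n + 1 : ℕ) u U := by
  push_cast
  refine (contDiffOn_succ_iff_deriv_of_isOpen hU).2
    ⟨fun x hx => (h x hx).differentiableAt.differentiableWithinAt, by simp, ?_⟩
  exact hu'.congr fun x hx => (h x hx).deriv

lemma deriv_reflection_identity {U : Set ℝ} (hU : IsOpen U) {F F' : ℝ → ℝ} {m ε : ℝ}
    (hF : ∀ x ∈ U, HasDerivAt F (F' x) x)
    (h : ∀ t, m + t ∈ U → m - t ∈ U → F (m + t) + ε * F (m - t) = 0) {t : ℝ}
    (h₁ : m + t ∈ U) (h₂ : m - t ∈ U) : F' (m + t) - ε * F' (m - t) = 0 := by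
  have e₁ : ∀ᶠ s in 𝓝 t, m + s ∈ U :=
    (by fun_prop : ContinuousAt (fun s => m + s) t).eventually_mem (hU.mem_nhds h₁)
  have e₂ : ∀ᶠ s in 𝓝 t, m - s ∈ U :=
    (by fun_prop : ContinuousAt (fun s => m - s) t).eventually_mem (hU.mem_nhds h₂)
  have d₁ : HasDerivAt (fun s => F (m + s)) (F' (m + t)) t := (hF _ h₁).comp_const_add m t
  have d₂ : HasDerivAt (fun s => F (m - s)) (-F' (m - t)) t := (hF _ h₂).comp_const_sub m t
  have d := d₁.add (d₂.const_mul ε)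
  have d₀ : HasDerivAt ((fun s => F (m + s)) + fun s => ε * F (m - s)) 0 t := by
    refine (hasDerivAt_const t (0 : ℝ)).congr_of_eventuallyEq ?_
    filter_upwards [e₁, e₂] with s h₁ h₂ using h s h₁ h₂
  linarith [d.unique d₀]

lemma IsSinCosPair.exists_eq_combination {γ : ℝ} {S C : ℝ → ℝ} (hSC : IsSinCosPair γ S C)
    {U : Set ℝ} (hU : IsOpen U) (hUc : U.OrdConnected) {u u' : ℝ → ℝ}
    (hu : ∀ x ∈ U, HasDerivAt u (u' x) x) (hu' : ∀ x ∈ U, HasDerivAt u' (γ * u x) x) :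
    ∃ a b, ∀ x ∈ U, u x = a * S x + b * C x := by
  obtain ⟨a, ha⟩ := exists_eq_const_of_hasDerivAt_zero hU hUc
    (u := fun x => u' x * C x - γ * (u x * S x)) fun x hx => by
      refine (((hu' x hx).mul (hSC.hasDerivAt_cos x)).sub
        (((hu x hx).mul (hSC.hasDerivAt_sin x)).const_mul γ)).congr_deriv ?_
      ring
  obtain ⟨b, hb⟩ := exists_eq_const_of_hasDerivAt_zero hU hUc
    (u := fun x => u x * C x - u' x * S x) fun x hx => by
      refine (((hu x hx).mul (hSC.hasDerivAt_cos x)).sub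
        ((hu' x hx).mul (hSC.hasDerivAt_sin x))).congr_deriv ?_
      ring
  refine ⟨a, b, fun x hx => ?_⟩
  rw [← ha x hx, ← hb x hx]
  linear_combination (-u x) * hSC.sq_sub_sq x

end Calculus

namespace SolvesMidpointEq

variable {φ f : ℝ → ℝ} {I U : Set ℝ}

lemma mono (h : SolvesMidpointEq φ f I) (hU : U ⊆ I) : SolvesMidpointEq φ f U :=
  fun x hx y hy => h x (hU hx) y (hU hy)

section ConstantOnSupport

variable {c : ℝ}

lemma neg_reflection (h : SolvesMidpointEq φ f I) (hc : ∀ x ∈ I, f x ≠ 0 → φ x = c) {p x y : ℝ}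
    (hp : φ p ≠ c) (hx : x ∈ I) (hy : y ∈ I) (hxy : x + y = 2 * p) : f y = -f x := by
  have key : ∀ z ∈ I, φ z * f z = c * f z := fun z hz => by
    by_cases hz0 : f z = 0
    · simp [hz0]
    · rw [hc z hz hz0]
  have e := h x hx y hy
  rw [key x hx, key y hy, hxy, mul_div_cancel_left₀ p two_ne_zero] at e
  have e' : (φ p - c) * (f x + f y) = 0 := by linear_combination e
  linarith [(mul_eq_zero.1 e').resolve_left (sub_ne_zero.2 hp)]

lemma eq_zero_of_ne (h : SolvesMidpointEq φ f I) (hI : IsOpen I) (hIc : I.OrdConnected)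
    (hφ : ContinuousOn φ I) (hc : ∀ x ∈ I, f x ≠ 0 → φ x = c) {p x y : ℝ}
    (hp : φ p ≠ c) (hx : x ∈ I) (hy : y ∈ I) (hxy : x + y = 2 * p) : f x = 0 := by
  have hpI : p ∈ I := by
    have := hIc.midpoint_mem hx hy
    rwa [hxy, mul_div_cancel_left₀ p two_ne_zero] at this
  let K : Set ℝ := {t | t ∈ I ∧ 2 * p - t ∈ I}
  have hK : K.OrdConnected := ⟨fun s hs t ht z hz =>
    ⟨hIc.out hs.1 ht.1 hz, hIc.out ht.2 hs.2 ⟨by linarith [hz.2], by linarith [hz.1]⟩⟩⟩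
  have hpK : p ∈ K := ⟨hpI, by rwa [two_mul, add_sub_cancel_right]⟩
  have hxK : x ∈ K := ⟨hx, by rwa [← hxy, add_sub_cancel_left]⟩
  have hloc : ∀ t ∈ K, ∀ᶠ s in 𝓝[K] t, f t = f s := fun t ht => by
    have hpt : (t + (2 * p - t)) / 2 = p := by ring
    have hcont : ContinuousAt (fun s => φ ((s + (2 * p - t)) / 2)) t := by
      have h' : ContinuousAt φ ((t + (2 * p - t)) / 2) := by
        rw [hpt]; exact hφ.continuousAt (hI.mem_nhds hpI)
      exact ContinuousAt.comp (f := fun s => (s + (2 * p - t)) / 2) h' (by fun_prop)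
    have hev : ∀ᶠ s in 𝓝 t, φ ((s + (2 * p - t)) / 2) ≠ c :=
      hcont.eventually_ne (by simpa [hpt] using hp)
    filter_upwards [nhdsWithin_le_nhds hev, self_mem_nhdsWithin] with s hs hsK
    have h₁ := h.neg_reflection hc hp ht.1 ht.2 (by ring)
    have h₂ := h.neg_reflection hc hs hsK.1 ht.2 (by ring)
    linarith
  have hxp : f x = f p := hK.isPreconnected.induction₂ (fun s t => f s = f t) hloc
    (fun _ _ _ _ _ _ => Eq.trans) (fun _ _ _ _ => Eq.symm) hxK hpK
  linarith [h.neg_reflection hc hp hpI hpI (by ring)]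

lemma exists_ordConnected_support (h : SolvesMidpointEq φ f I) (hI : IsOpen I)
    (hIc : I.OrdConnected) (hφ : ContinuousOn φ I) (hc : ∀ x ∈ I, f x ≠ 0 → φ x = c) :
    ∃ J : Set ℝ, J ⊆ I ∧ J.OrdConnected ∧ (∀ x ∈ I \ J, f x = 0) ∧
      ∃ c : ℝ, ∀ u ∈ J, ∀ v ∈ I, φ ((u + v) / 2) = c := by
  refine ⟨{u | ∃ s ∈ I, f s ≠ 0 ∧ ∃ t ∈ I, f t ≠ 0 ∧ s ≤ u ∧ u ≤ t}, ?_, ?_, ?_, c, ?_⟩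
  · rintro u ⟨s, hs, -, t, ht, -, h₁, h₂⟩
    exact hIc.out hs ht ⟨h₁, h₂⟩
  · refine ⟨?_⟩
    rintro u ⟨s, hs, hs0, -, -, -, h₁, -⟩ v ⟨-, -, -, t, ht, ht0, -, h₂⟩ z hz
    exact ⟨s, hs, hs0, t, ht, ht0, h₁.trans hz.1, hz.2.trans h₂⟩
  · rintro x ⟨hx, hxJ⟩
    by_contra h0
    exact hxJ ⟨x, hx, h0, x, hx, h0, le_rfl, le_rfl⟩
  · rintro u ⟨s, hs, hs0, t, ht, ht0, h₁, h₂⟩ v hv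
    by_contra hp
    have hs' : s + t < u + v := by
      by_contra! hle
      exact hs0 (h.eq_zero_of_ne hI hIc hφ hc hp hs
        (hIc.out hv ht ⟨by linarith, by linarith⟩ : u + v - s ∈ I) (by ring))
    exact ht0 (h.eq_zero_of_ne hI hIc hφ hc hp ht
      (hIc.out hs hv ⟨by linarith, by linarith⟩ : u + v - t ∈ I) (by ring))

end ConstantOnSupport

lemma eq_of_forall_midpoint_eq (h : SolvesMidpointEq φ f I) {x₀ : ℝ} (hx₀ : x₀ ∈ I)
    (hc : ∀ y ∈ I, φ ((x₀ + y) / 2) = φ x₀) : ∀ y ∈ I, f y ≠ 0 → φ y = φ x₀ := by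
  intro y hy hy0
  have e := h x₀ hx₀ y hy
  rw [hc y hy] at e
  exact (mul_right_cancel₀ hy0 (by linear_combination e)).symm

lemma contDiffAt (h : SolvesMidpointEq φ f I) (hI : IsOpen I) (hIc : I.OrdConnected)
    {n : WithTop ℕ∞} (hφ : ContDiffOn ℝ n φ I) {x y : ℝ} (hx : x ∈ I) (hy : y ∈ I)
    (hne : φ ((x + y) / 2) ≠ φ x) : ContDiffAt ℝ n f x := by
  have d₁ : ContDiffAt ℝ n φ x := hφ.contDiffAt (hI.mem_nhds hx)
  have d₂ : ContDiffAt ℝ n (fun t => φ ((t + y) / 2)) x :=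
    ContDiffAt.comp (f := fun t => (t + y) / 2) x
      (hφ.contDiffAt (hI.mem_nhds (hIc.midpoint_mem hx hy))) (by fun_prop)
  have hsub : φ x - φ ((x + y) / 2) ≠ 0 := sub_ne_zero.2 hne.symm
  have d := (((d₂.sub (contDiffAt_const (c := φ y))).mul (contDiffAt_const (c := f y))).div
    (d₁.sub d₂) hsub)
  refine d.congr_of_eventuallyEq ?_
  have hev : ∀ᶠ t in 𝓝 x, φ t - φ ((t + y) / 2) ≠ 0 :=
    (d₁.sub d₂).continuousAt.eventually_ne hsub
  filter_upwards [hev, hI.mem_nhds hx] with t ht htI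
  have e := h t htI y hy
  change f t = (φ ((t + y) / 2) - φ y) * f y / (φ t - φ ((t + y) / 2))
  rw [eq_div_iff ht]
  linear_combination -e

lemma contDiffOn_succ (h : SolvesMidpointEq φ f U) (hU : IsOpen U) (hUc : U.OrdConnected)
    (hf0 : ∀ x ∈ U, f x ≠ 0) {n : ℕ} (hφ : ContDiffOn ℝ n φ U) (hf : ContDiffOn ℝ n f U) :
    ContDiffOn ℝ (n + 1 : ℕ) φ U := by
  obtain ⟨F, hF⟩ := exists_primitive hU hUc hf.continuousOn
  obtain ⟨G, hG⟩ := exists_primitive hU hUc (hφ.mul hf).continuousOn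
  have cF := contDiffOn_succ_of_hasDerivAt hU hF hf
  have cG := contDiffOn_succ_of_hasDerivAt hU hG (hφ.mul hf)
  have key : ∀ m ε, 0 < ε → m + ε ∈ U → m - ε ∈ U →
      φ m * (F (m + ε) - F (m - ε)) = G (m + ε) - G (m - ε) := by
    intro m ε hε h₁ h₂
    have hsub : Icc (0 : ℝ) ε ⊆ {t | m + t ∈ U ∧ m - t ∈ U} := fun t ht =>
      ⟨hUc.out h₂ h₁ ⟨by linarith [ht.1], by linarith [ht.2]⟩,
        hUc.out h₂ h₁ ⟨by linarith [ht.2], by linarith [ht.1]⟩⟩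
    let D : ℝ → ℝ := fun t => φ m * (F (m + t) - F (m - t)) - (G (m + t) - G (m - t))
    have hD : ∀ t ∈ Icc (0 : ℝ) ε, HasDerivAt D 0 t := fun t ht => by
      obtain ⟨h₁, h₂⟩ := hsub ht
      have d := ((((hF _ h₁).comp_const_add m t).sub ((hF _ h₂).comp_const_sub m t)).const_mul
        (φ m)).sub (((hG _ h₁).comp_const_add m t).sub ((hG _ h₂).comp_const_sub m t))
      refine d.congr_deriv ?_
      have e := h _ h₁ _ h₂
      rw [show (m + t + (m - t)) / 2 = m by ring] at e
      change _ * (_ - -_) - (φ _ * f _ - -(φ _ * f _)) = 0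
      linear_combination e
    have hc : D ε = D 0 := constant_of_has_deriv_right_zero
      (fun t ht => (hD t ht).continuousAt.continuousWithinAt)
      (fun t ht => (hD t (Ico_subset_Icc_self ht)).hasDerivWithinAt) ε ⟨hε.le, le_rfl⟩
    simp only [D, add_zero, sub_zero, sub_self, mul_zero] at hc
    linarith
  have hFne : ∀ m ε, 0 < ε → m + ε ∈ U → m - ε ∈ U → F (m + ε) - F (m - ε) ≠ 0 := by
    intro m ε hε h₁ h₂ h0
    have hsub := hUc.out h₂ h₁
    obtain ⟨z, hz, hz0⟩ := exists_hasDerivAt_eq_zero (by linarith : m - ε < m + ε)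
      (fun t ht => (hF t (hsub ht)).continuousAt.continuousWithinAt) (by linarith)
      (fun t ht => hF t (hsub (Ioo_subset_Icc_self ht)))
    exact hf0 z (hsub (Ioo_subset_Icc_self hz)) hz0
  intro m hm
  obtain ⟨ε, hε, hball⟩ := Metric.isOpen_iff.1 hU m hm
  have h₁ : m + ε / 2 ∈ U := hball (by simp [abs_of_pos hε]; linarith)
  have h₂ : m - ε / 2 ∈ U := hball (by simp [abs_of_pos hε]; linarith)
  have s₁ : ∀ {H : ℝ → ℝ}, ContDiffOn ℝ (n + 1 : ℕ) H U →
      ContDiffAt ℝ (n + 1 : ℕ) (fun t => H (t + ε / 2) - H (t - ε / 2)) m := fun hH =>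
    (ContDiffAt.comp (f := fun t => t + ε / 2) m (hH.contDiffAt (hU.mem_nhds h₁))
      (by fun_prop)).sub
    (ContDiffAt.comp (f := fun t => t - ε / 2) m (hH.contDiffAt (hU.mem_nhds h₂)) (by fun_prop))
  refine (((s₁ cG).div (s₁ cF) (hFne m _ (half_pos hε) h₁ h₂)).congr_of_eventuallyEq
    ?_).contDiffWithinAt
  have e₁ : ∀ᶠ s in 𝓝 m, s + ε / 2 ∈ U :=
    (by fun_prop : ContinuousAt (fun s => s + ε / 2) m).eventually_mem (hU.mem_nhds h₁)
  have e₂ : ∀ᶠ s in 𝓝 m, s - ε / 2 ∈ U :=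
    (by fun_prop : ContinuousAt (fun s => s - ε / 2) m).eventually_mem (hU.mem_nhds h₂)
  filter_upwards [e₁, e₂] with s h₁ h₂
  change φ s = (G (s + ε / 2) - G (s - ε / 2)) / (F (s + ε / 2) - F (s - ε / 2))
  rw [eq_div_iff (hFne s _ (half_pos hε) h₁ h₂)]
  exact key s _ (half_pos hε) h₁ h₂

lemma contDiffOn_nat (h : SolvesMidpointEq φ f U) (hU : IsOpen U) (hUc : U.OrdConnected)
    (hf0 : ∀ x ∈ U, f x ≠ 0) (hφ : ContinuousOn φ U) (hnc : ¬ ∃ c, ∀ x ∈ U, φ x = c) (n : ℕ) :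
    ContDiffOn ℝ n φ U ∧ ContDiffOn ℝ n f U := by
  have hmid : ∀ x ∈ U, ∃ y ∈ U, φ ((x + y) / 2) ≠ φ x := fun x hx => by
    by_contra! hc
    exact hnc ⟨φ x, fun y hy => h.eq_of_forall_midpoint_eq hx hc y hy (hf0 y hy)⟩
  have step : ∀ {n : ℕ}, ContDiffOn ℝ n φ U → ContDiffOn ℝ n f U := fun hn x hx => by
    obtain ⟨y, hy, hne⟩ := hmid x hx
    exact (h.contDiffAt hU hUc hn hx hy hne).contDiffWithinAt
  suffices hφn : ContDiffOn ℝ n φ U from ⟨hφn, step hφn⟩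
  induction n with
  | zero => simpa using hφ
  | succ n ih => exact h.contDiffOn_succ hU hUc hf0 ih (step ih)

lemma second_deriv (h : SolvesMidpointEq φ f U) (hU : IsOpen U)
    {φ₁ φ₂ f₁ f₂ : ℝ → ℝ} (hφ : ∀ x ∈ U, HasDerivAt φ (φ₁ x) x)
    (hφ₁ : ∀ x ∈ U, HasDerivAt φ₁ (φ₂ x) x) (hf : ∀ x ∈ U, HasDerivAt f (f₁ x) x)
    (hf₁ : ∀ x ∈ U, HasDerivAt f₁ (f₂ x) x) :
    SolvesMidpointEq φ f₂ U ∧ ∀ x ∈ U, φ₂ x * f x + 2 * (φ₁ x * f₁ x) = 0 := by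
  have key : ∀ x ∈ U, ∀ y ∈ U, φ ((x + y) / 2) * (f₂ x + f₂ y) =
      (φ₂ x * f x + 2 * (φ₁ x * f₁ x) + φ x * f₂ x) +
        (φ₂ y * f y + 2 * (φ₁ y * f₁ y) + φ y * f₂ y) := by
    intro x hx y hy
    set m := (x + y) / 2 with hm
    have d₀ : ∀ t ∈ U, HasDerivAt (fun t => φ m * f t - φ t * f t)
        (φ m * f₁ t - (φ₁ t * f t + φ t * f₁ t)) t := fun t ht =>
      ((hf t ht).const_mul _).sub ((hφ t ht).mul (hf t ht))
    have d₁ : ∀ t ∈ U, HasDerivAt (fun t => φ m * f₁ t - (φ₁ t * f t + φ t * f₁ t))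
        (φ m * f₂ t - ((φ₂ t * f t + φ₁ t * f₁ t) + (φ₁ t * f₁ t + φ t * f₂ t))) t :=
      fun t ht => ((hf₁ t ht).const_mul _).sub
        (((hφ₁ t ht).mul (hf t ht)).add ((hφ t ht).mul (hf₁ t ht)))
    have h₀ : ∀ t, m + t ∈ U → m - t ∈ U → (φ m * f (m + t) - φ (m + t) * f (m + t)) +
        1 * (φ m * f (m - t) - φ (m - t) * f (m - t)) = 0 := fun t h₁ h₂ => by
      have e := h _ h₁ _ h₂
      rw [show (m + t + (m - t)) / 2 = m by ring] at e
      linear_combination e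
    have h₁ := fun t h₁ h₂ => deriv_reflection_identity hU d₀ h₀ (t := t) h₁ h₂
    have ex : m + (x - y) / 2 = x := by rw [hm]; ring
    have ey : m - (x - y) / 2 = y := by rw [hm]; ring
    have h₂ := deriv_reflection_identity hU d₁ (m := m) (ε := -1) (t := (x - y) / 2)
      (fun t a b => by linear_combination h₁ t a b) (by rwa [ex]) (by rwa [ey])
    rw [ex, ey] at h₂
    linear_combination h₂
  have hz : ∀ x ∈ U, φ₂ x * f x + 2 * (φ₁ x * f₁ x) = 0 := fun x hx => by
    have e := key x hx x hx
    rw [show (x + x) / 2 = x by ring] at e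
    linarith
  refine ⟨fun x hx y hy => ?_, hz⟩
  rw [key x hx y hy, hz x hx, hz y hy]
  ring

/-- Where `f` does not vanish and `φ` is not constant, `f` and `φ f` solve one common linear
second-order equation with constant coefficients and are linearly independent. -/
lemma exists_combination (h : SolvesMidpointEq φ f U) (hU : IsOpen U) (hUc : U.OrdConnected)
    (hne : U.Nonempty) (hf0 : ∀ x ∈ U, f x ≠ 0) (hφ : ContinuousOn φ U)
    (hnc : ¬ ∃ c, ∀ x ∈ U, φ x = c) :
    ∃ γ, ∀ S C, IsSinCosPair γ S C → ∃ a b c d, a * d ≠ b * c ∧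
      ∀ x ∈ U, f x = a * S x + b * C x ∧ φ x * f x = c * S x + d * C x := by
  obtain ⟨φ₁, dφ, c₁⟩ := (h.contDiffOn_nat hU hUc hf0 hφ hnc (1 + 1)).1.exists_hasDerivAt hU
  obtain ⟨φ₂, dφ₁, -⟩ := ContDiffOn.exists_hasDerivAt (n := 0) hU c₁
  obtain ⟨f₁, df, c₁⟩ := (h.contDiffOn_nat hU hUc hf0 hφ hnc (3 + 1)).2.exists_hasDerivAt hU
  obtain ⟨f₂, df₁, c₁⟩ := ContDiffOn.exists_hasDerivAt (n := 2) hU c₁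
  obtain ⟨f₃, df₂, c₁⟩ := ContDiffOn.exists_hasDerivAt (n := 1) hU c₁
  obtain ⟨f₄, df₃, -⟩ := ContDiffOn.exists_hasDerivAt (n := 0) hU c₁
  obtain ⟨h₂, hz⟩ := h.second_deriv hU dφ dφ₁ df df₁
  have hz₂ := (h₂.second_deriv hU dφ dφ₁ df₂ df₃).2
  obtain ⟨k, hk⟩ := exists_eq_const_of_hasDerivAt_zero hU hUc
    (u := fun x => φ₁ x * (f x * f x)) fun x hx => by
      refine ((dφ₁ x hx).mul ((df x hx).mul (df x hx))).congr_deriv ?_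
      change φ₂ x * (f x * f x) + φ₁ x * (f₁ x * f x + f x * f₁ x) = 0
      linear_combination f x * hz x hx
  have hφ₁0 : ∀ x ∈ U, φ₁ x ≠ 0 := fun x hx h0 => by
    have hk0 : k = 0 := by rw [← hk x hx, h0, zero_mul]
    refine hnc (exists_eq_const_of_hasDerivAt_zero hU hUc fun y hy => ?_)
    have hy1 : φ₁ y = 0 :=
      (mul_eq_zero.1 ((hk y hy).trans hk0)).resolve_right (mul_ne_zero (hf0 y hy) (hf0 y hy))
    exact hy1 ▸ dφ y hy
  obtain ⟨γ, hγ⟩ := exists_eq_const_of_hasDerivAt_zero hU hUc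
    (u := fun x => f₂ x / f x) fun x hx => by
      refine ((df₂ x hx).div (df x hx) (hf0 x hx)).congr_deriv ?_
      have e : φ₁ x * (f₃ x * f x - f₂ x * f₁ x) = 0 := by
        linear_combination (1 / 2) * f x * hz₂ x hx - (1 / 2) * f₂ x * hz x hx
      rw [(mul_eq_zero.1 e).resolve_left (hφ₁0 x hx), zero_div]
  have hγ' : ∀ x ∈ U, f₂ x = γ * f x := fun x hx => (div_eq_iff (hf0 x hx)).1 (hγ x hx)
  refine ⟨γ, fun S C hSC => ?_⟩
  obtain ⟨a, b, hab⟩ := hSC.exists_eq_combination hU hUc df fun x hx => hγ' x hx ▸ df₁ x hx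
  obtain ⟨c, d, hcd⟩ := hSC.exists_eq_combination hU hUc
    (u := fun x => φ x * f x) (u' := fun x => φ₁ x * f x + φ x * f₁ x)
    (fun x hx => (dφ x hx).mul (df x hx)) fun x hx => by
      refine (((dφ₁ x hx).mul (df x hx)).add ((dφ x hx).mul (df₁ x hx))).congr_deriv ?_
      linear_combination hz x hx + φ x * hγ' x hx
  refine ⟨a, b, c, d, fun hdet => hnc ?_, fun x hx => ⟨hab x hx, hcd x hx⟩⟩
  by_cases ha : a = 0
  · have hb : b ≠ 0 := by
      rintro rfl
      obtain ⟨x, hx⟩ := hne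
      exact hf0 x hx (by rw [hab x hx, ha]; ring)
    have hc : c = 0 := by
      rw [ha, zero_mul] at hdet
      exact (mul_eq_zero.1 hdet.symm).resolve_left hb
    refine ⟨d / b, fun x hx => ?_⟩
    have e := hcd x hx
    have hfx := hf0 x hx
    rw [eq_div_iff hb]
    refine mul_right_cancel₀ hfx ?_
    linear_combination b * e - d * hab x hx + b * S x * hc - d * S x * ha
  · refine ⟨c / a, fun x hx => ?_⟩
    have e := hcd x hx
    rw [eq_div_iff ha]
    refine mul_right_cancel₀ (hf0 x hx) ?_
    linear_combination a * e - c * hab x hx + C x * hdet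

/-- If `φ` is constant on every interval on which `f` has no zero, then `φ` is constant on the
support of `f`. -/
lemma eq_of_eqOn_intervals (h : SolvesMidpointEq φ f I) (hIc : I.OrdConnected)
    (hφ : ContinuousOn φ I) (hS : IsOpen {x ∈ I | f x ≠ 0})
    (hconst : ∀ a ∈ I, ∀ b ∈ I, (∀ x ∈ uIcc a b, f x ≠ 0) → φ a = φ b)
    {u v : ℝ} (hu : u ∈ I) (hv : v ∈ I) (hu0 : f u ≠ 0) (hv0 : f v ≠ 0) (huv : u ≤ v) :
    φ u = φ v := by
  have hsub : Icc u v ⊆ I := hIc.out hu hv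
  have hZeq : Icc u v ∩ {x ∈ I | f x ≠ 0}ᶜ = {x ∈ Icc u v | f x = 0} := by
    ext x
    constructor
    · rintro ⟨hx, hx'⟩
      exact ⟨hx, by by_contra h0; exact hx' ⟨hsub hx, h0⟩⟩
    · rintro ⟨hx, hx'⟩
      exact ⟨hx, fun h0 => h0.2 hx'⟩
  have hZ : IsCompact {x ∈ Icc u v | f x = 0} :=
    hZeq ▸ isCompact_Icc.inter_right hS.isClosed_compl
  rcases {x ∈ Icc u v | f x = 0}.eq_empty_or_nonempty with hem | hnonem
  · refine hconst u hu v hv fun x hx h0 => ?_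
    rw [uIcc_of_le huv] at hx
    exact (hem ▸ (⟨hx, h0⟩ : x ∈ {x ∈ Icc u v | f x = 0}) : x ∈ (∅ : Set ℝ))
  obtain ⟨β, ⟨hβ, hβ0⟩, hβmin⟩ := hZ.exists_isLeast hnonem
  obtain ⟨α, ⟨hα, hα0⟩, hαmax⟩ := hZ.exists_isGreatest hnonem
  have huβ : u < β := lt_of_le_of_ne hβ.1 fun e => hu0 (e ▸ hβ0)
  have hαv : α < v := lt_of_le_of_ne hα.2 fun e => hv0 (e ▸ hα0)
  have hmid : ∀ x ∈ I, f x ≠ 0 → ∀ z ∈ I, f z = 0 → φ ((x + z) / 2) = φ x := by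
    intro x hx hx0 z hz hz0
    have e := h x hx z hz
    rw [hz0, add_zero, mul_zero, add_zero] at e
    exact mul_right_cancel₀ hx0 e
  have hlim : ∀ p ∈ Icc u v, ∀ q ∈ Icc u v, ∀ T ⊆ Icc u v, p ∈ closure T → ∀ w,
      (∀ x ∈ T, φ ((x + q) / 2) = w) → φ ((p + q) / 2) = w := by
    intro p hp q hq T hT hpT w hw
    have hc : ContinuousOn (fun x => φ ((x + q) / 2)) (Icc u v) :=
      hφ.comp (by fun_prop) fun x hx => hIc.midpoint_mem (hsub hx) (hsub hq)
    have := mem_closure_iff_nhdsWithin_neBot.1 hpT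
    refine tendsto_nhds_unique ((hc p hp).mono_left (nhdsWithin_mono p hT)) ?_
    refine tendsto_const_nhds.congr' ?_
    filter_upwards [self_mem_nhdsWithin] with x hx using (hw x hx).symm
  have h₁ : φ ((β + α) / 2) = φ u := by
    refine hlim β hβ α hα (Ico u β) (fun x hx => ⟨hx.1, hx.2.le.trans hβ.2⟩)
      (by rw [closure_Ico huβ.ne]; exact ⟨huβ.le, le_rfl⟩) _ fun x hx => ?_
    have hxI : x ∈ Icc u v := ⟨hx.1, hx.2.le.trans hβ.2⟩
    have hnz : ∀ y ∈ Icc u x, f y ≠ 0 := fun y hy h0 =>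
      (hy.2.trans_lt hx.2).not_ge (hβmin ⟨⟨hy.1, hy.2.trans hxI.2⟩, h0⟩)
    rw [hmid x (hsub hxI) (hnz x ⟨hx.1, le_rfl⟩) α (hsub hα) hα0]
    exact (hconst u hu x (hsub hxI) (by rwa [uIcc_of_le hx.1])).symm
  have h₂ : φ ((α + β) / 2) = φ v := by
    refine hlim α hα β hβ (Ioc α v) (fun x hx => ⟨hα.1.trans hx.1.le, hx.2⟩)
      (by rw [closure_Ioc hαv.ne]; exact ⟨le_rfl, hαv.le⟩) _ fun x hx => ?_
    have hxI : x ∈ Icc u v := ⟨hα.1.trans hx.1.le, hx.2⟩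
    have hnz : ∀ y ∈ Icc x v, f y ≠ 0 := fun y hy h0 =>
      (hx.1.trans_le hy.1).not_ge (hαmax ⟨⟨hxI.1.trans hy.1, hy.2⟩, h0⟩)
    rw [hmid x (hsub hxI) (hnz x ⟨le_rfl, hx.2⟩) β (hsub hβ) hβ0]
    exact hconst x (hsub hxI) v hv (by rwa [uIcc_of_le hx.2])
  rw [← h₁, ← h₂, add_comm]

/-- If `f` and `φ f` are linearly independent generalized trigonometric functions on `U` and `f`
vanishes at the boundary of `U` in `I`, then there is no such boundary. -/
lemma _root_.subset_of_eqOn_combination (hI : IsOpen I) (hIc : I.OrdConnected)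
    (hφ : ContinuousOn φ I) (hf : ContinuousOn f I) (hU : IsOpen U) (hne : U.Nonempty) (hUI : U ⊆ I)
    (hbd : ∀ β ∈ closure U ∩ I, β ∉ U → f β = 0)
    {γ a b c d : ℝ} {S C : ℝ → ℝ} (hSC : IsSinCosPair γ S C) (hdet : a * d ≠ b * c)
    (hfU : ∀ x ∈ U, f x = a * S x + b * C x ∧ φ x * f x = c * S x + d * C x) : I ⊆ U := by
  obtain ⟨x₀, hx₀⟩ := hne
  refine hIc.isPreconnected.subset_of_closure_inter_subset hU ⟨x₀, hUI hx₀, hx₀⟩ ?_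
  rintro β ⟨hβU, hβI⟩
  by_contra hβ
  have hfβ := hbd β ⟨hβU, hβI⟩ hβ
  have := mem_closure_iff_nhdsWithin_neBot.1 hβU
  have cS : Continuous S := continuous_iff_continuousAt.2 fun x =>
    (hSC.hasDerivAt_sin x).continuousAt
  have cC : Continuous C := continuous_iff_continuousAt.2 fun x =>
    (hSC.hasDerivAt_cos x).continuousAt
  have hφβ : ContinuousAt φ β := hφ.continuousAt (hI.mem_nhds hβI)
  have cF : ContinuousAt (fun x => a * S x + b * C x) β := by fun_prop
  have cG : ContinuousAt (fun x => c * S x + d * C x) β := by fun_prop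
  have hG : φ β * (a * S β + b * C β) = c * S β + d * C β := by
    refine tendsto_nhds_unique (l := 𝓝[U] β) ((hφβ.mul cF).mono_left nhdsWithin_le_nhds)
      ((cG.mono_left nhdsWithin_le_nhds).congr' ?_)
    filter_upwards [self_mem_nhdsWithin] with x hx
    rw [← (hfU x hx).2, (hfU x hx).1]
    rfl
  have hF : a * S β + b * C β ≠ 0 := fun h0 => by
    rw [h0, mul_zero] at hG
    have hs := hSC.sq_sub_sq β
    have h1 : (a * d - b * c) * S β = 0 := by linear_combination d * h0 + b * hG
    have h2 : (a * d - b * c) * C β = 0 := by linear_combination (-c) * h0 - a * hG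
    have hdet' := sub_ne_zero.2 hdet
    rw [(mul_eq_zero.1 h1).resolve_left hdet', (mul_eq_zero.1 h2).resolve_left hdet'] at hs
    norm_num at hs
  have hlim := (hf.continuousAt (hI.mem_nhds hβI)).tendsto.mono_left
    (nhdsWithin_le_nhds (s := U))
  refine hF ((tendsto_nhds_unique (l := 𝓝[U] β) hlim
    ((cF.mono_left nhdsWithin_le_nhds).congr' ?_)).symm.trans hfβ)
  filter_upwards [self_mem_nhdsWithin] with x hx using (hfU x hx).1.symm

theorem const_or_combination (h : SolvesMidpointEq φ f I) (hI : IsOpen I)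
    (hIc : I.OrdConnected) (hφ : ContinuousOn φ I) :
    (∃ c, ∀ x ∈ I, f x ≠ 0 → φ x = c) ∨
      (∃ γ, ∀ S C, IsSinCosPair γ S C → ∃ a b c d, a * d ≠ b * c ∧ ∀ x ∈ I, f x ≠ 0 ∧
        f x = a * S x + b * C x ∧ φ x * f x = c * S x + d * C x) := by
  by_cases hconst : ∃ c, ∀ x ∈ I, f x ≠ 0 → φ x = c
  · exact Or.inl hconst
  right
  have hmid : ∀ x ∈ I, ∃ y ∈ I, φ ((x + y) / 2) ≠ φ x := fun x hx => by
    by_contra! hc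
    exact hconst ⟨φ x, h.eq_of_forall_midpoint_eq hx hc⟩
  have hfc : ContinuousOn f I := fun x hx => by
    obtain ⟨y, hy, hyne⟩ := hmid x hx
    exact (h.contDiffAt hI hIc (n := 0) (contDiffOn_zero.2 hφ) hx hy
      hyne).continuousAt.continuousWithinAt
  have hS : IsOpen {x ∈ I | f x ≠ 0} := hfc.isOpen_inter_preimage hI isOpen_compl_singleton
  have hnonconst : ∃ a ∈ I, ∃ b ∈ I, (∀ x ∈ uIcc a b, f x ≠ 0) ∧ φ a ≠ φ b := by
    by_contra! hc
    have key := fun u hu v hv hu0 hv0 huv =>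
      h.eq_of_eqOn_intervals hIc hφ hS hc (u := u) (v := v) hu hv hu0 hv0 huv
    by_cases hz : ∃ u ∈ I, f u ≠ 0
    · obtain ⟨u, hu, hu0⟩ := hz
      refine hconst ⟨φ u, fun x hx hx0 => ?_⟩
      rcases le_total x u with hxu | hux
      · exact key x hx u hu hx0 hu0 hxu
      · exact (key u hu x hx hu0 hx0 hux).symm
    · exact hconst ⟨0, fun x hx hx0 => (hz ⟨x, hx, hx0⟩).elim⟩
  obtain ⟨a, ha, b, hb, hab, hφab⟩ := hnonconst
  let U := connectedComponentIn {x ∈ I | f x ≠ 0} a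
  have haS : a ∈ {x ∈ I | f x ≠ 0} := ⟨ha, hab a left_mem_uIcc⟩
  have haU : a ∈ U := mem_connectedComponentIn haS
  have hUS : U ⊆ {x ∈ I | f x ≠ 0} := connectedComponentIn_subset _ _
  have hUI : U ⊆ I := fun x hx => (hUS hx).1
  have hU : IsOpen U := hS.connectedComponentIn
  have hUp : IsPreconnected U := isPreconnected_connectedComponentIn
  have habS : uIcc a b ⊆ {x ∈ I | f x ≠ 0} :=
    fun x hx => ⟨hIc.uIcc_subset ha hb hx, hab x hx⟩
  have hbU : b ∈ U :=
    isPreconnected_uIcc.subset_connectedComponentIn left_mem_uIcc habS right_mem_uIcc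
  have hbd : ∀ β ∈ closure U ∩ I, β ∉ U → f β = 0 := by
    rintro β ⟨hβ, hβI⟩ hβU
    by_contra h0
    have hβS : β ∈ {x ∈ I | f x ≠ 0} := ⟨hβI, h0⟩
    exact hβU ((hUp.subset_closure (subset_insert β U)
      (insert_subset hβ subset_closure)).subset_connectedComponentIn
      (mem_insert_of_mem β haU) (insert_subset hβS hUS) (mem_insert β U))
  obtain ⟨γ, hγ⟩ := (h.mono hUI).exists_combination hU hUp.ordConnected ⟨a, haU⟩
    (fun x hx => (hUS hx).2) (hφ.mono hUI)
    fun ⟨c, hc⟩ => hφab ((hc a haU).trans (hc b hbU).symm)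
  refine ⟨γ, fun S C hSC => ?_⟩
  obtain ⟨p, q, r, t, hdet, hpq⟩ := hγ S C hSC
  have hIU := subset_of_eqOn_combination hI hIc hφ hfc hU ⟨a, haU⟩ hUI hbd hSC hdet hpq
  exact ⟨p, q, r, t, hdet, fun x hx => ⟨(hUS (hIU hx)).2, hpq x (hIU hx)⟩⟩

lemma of_ordConnected_support {J : Set ℝ} (hf : ∀ x ∈ I \ J, f x = 0) {c : ℝ}
    (hJ : J ⊆ I) (hc : ∀ u ∈ J, ∀ v ∈ I, φ ((u + v) / 2) = c) : SolvesMidpointEq φ f I := by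
  have hself : ∀ x ∈ J, φ x = c := fun x hx => by
    simpa using hc x hx x (hJ hx)
  intro x hx y hy
  by_cases hxJ : x ∈ J
  · by_cases hyJ : y ∈ J
    · rw [hc x hxJ y hy, hself x hxJ, hself y hyJ]; ring
    · rw [hc x hxJ y hy, hself x hxJ, hf y ⟨hy, hyJ⟩]; ring
  · by_cases hyJ : y ∈ J
    · rw [add_comm x y, hc y hyJ x hx, hself y hyJ, hf x ⟨hx, hxJ⟩]; ring
    · rw [hf x ⟨hx, hxJ⟩, hf y ⟨hy, hyJ⟩]; ring

/-- A quotient of two functions satisfying the same cosine-type addition formula solves the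
functional equation. -/
lemma of_quotient {F G κ : ℝ → ℝ} (hI : I.OrdConnected)
    (hF : ∀ m t, F (m + t) + F (m - t) = 2 * κ t * F m)
    (hG : ∀ m t, G (m + t) + G (m - t) = 2 * κ t * G m)
    (h : ∀ x ∈ I, f x = F x ∧ f x ≠ 0 ∧ φ x = G x / F x) : SolvesMidpointEq φ f I := by
  have hφf : ∀ x ∈ I, φ x * f x = G x := fun x hx => by
    obtain ⟨h₁, h₀, h₂⟩ := h x hx
    rw [h₂, ← h₁, div_mul_cancel₀ _ h₀]
  intro x hx y hy
  have hm := hI.midpoint_mem hx hy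
  have eF := hF ((x + y) / 2) ((x - y) / 2)
  have eG := hG ((x + y) / 2) ((x - y) / 2)
  rw [show (x + y) / 2 + (x - y) / 2 = x by ring, show (x + y) / 2 - (x - y) / 2 = y by ring]
    at eF eG
  rw [hφf x hx, hφf y hy, eG, ← hφf _ hm, (h x hx).1, (h y hy).1, eF, ← (h _ hm).1]
  ring

end SolvesMidpointEq

lemma isSinCosPair_sin {w : ℝ} (hw : w ≠ 0) :
    IsSinCosPair (-w ^ 2) (fun x => Real.sin (w * x) / w) fun x => Real.cos (w * x) where
  hasDerivAt_sin x := by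
    have d := (((hasDerivAt_id x).const_mul w).sin).div_const w
    refine d.congr_deriv ?_
    simp [hw]
  hasDerivAt_cos x := by
    refine (((hasDerivAt_id x).const_mul w).cos).congr_deriv ?_
    simp only [id_eq, mul_one]
    field_simp
  sq_sub_sq x := by
    field_simp
    linear_combination Real.sin_sq_add_cos_sq (w * x)

lemma isSinCosPair_id : IsSinCosPair 0 id fun _ => 1 where
  hasDerivAt_sin := hasDerivAt_id
  hasDerivAt_cos x := (hasDerivAt_const x 1).congr_deriv (by simp)
  sq_sub_sq x := by simp

lemma isSinCosPair_sinh {w : ℝ} (hw : w ≠ 0) :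
    IsSinCosPair (w ^ 2) (fun x => Real.sinh (w * x) / w) fun x => Real.cosh (w * x) where
  hasDerivAt_sin x := by
    have d := (((hasDerivAt_id x).const_mul w).sinh).div_const w
    refine d.congr_deriv ?_
    simp [hw]
  hasDerivAt_cos x := by
    refine (((hasDerivAt_id x).const_mul w).cosh).congr_deriv ?_
    simp only [id_eq, mul_one]
    field_simp
  sq_sub_sq x := by
    field_simp
    linear_combination Real.cosh_sq_sub_sinh_sq (w * x)


/-- Let `φ, f : I → ℝ` with `φ` continuous and
`Z_f^c ⊆ cl(conv((cl̄ Z_f)^c))`.  Then `(φ, f)` solves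
`φ((x+y)/2)(f(x)+f(y)) = φ(x)f(x) + φ(y)f(y)` on `I` iff either
(a) there exists an interval `J ⊆ I` such that `f = 0` on `I \ J` and `φ` is constant
on `½(J + I)`; or (b) there exist constants `a, b, c, d, γ` with `ad ≠ bc` such that
`f` and `φ` have the trigonometric / affine / hyperbolic forms according to the sign
of `γ`, with `f` nowhere zero on `I`. -/
theorem stmt15 (I : Set ℝ) (hIopen : IsOpen I) (hIconn : I.OrdConnected)
    (hIne : I.Nonempty) (φ f : ℝ → ℝ)
    (hφ : ContinuousOn φ I)
    (hreg : {x ∈ I | f x ≠ 0} ⊆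
      closure (convexHull ℝ (I \ closure {z ∈ I | f z = 0}))) :
    (∀ x ∈ I, ∀ y ∈ I,
        φ ((x + y) / 2) * (f x + f y) = φ x * f x + φ y * f y) ↔
      ((∃ J : Set ℝ, J ⊆ I ∧ J.OrdConnected ∧ (∀ x ∈ I \ J, f x = 0) ∧
          ∃ c : ℝ, ∀ u ∈ J, ∀ v ∈ I, φ ((u + v) / 2) = c) ∨
        (∃ a b c d γ : ℝ, a * d ≠ b * c ∧
          ((γ < 0 ∧ ∀ x ∈ I,
              f x = a * Real.sin (Real.sqrt (-γ) * x) + b * Real.cos (Real.sqrt (-γ) * x) ∧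
              f x ≠ 0 ∧
              φ x = (c * Real.sin (Real.sqrt (-γ) * x) + d * Real.cos (Real.sqrt (-γ) * x)) /
                (a * Real.sin (Real.sqrt (-γ) * x) + b * Real.cos (Real.sqrt (-γ) * x))) ∨
            (γ = 0 ∧ ∀ x ∈ I,
              f x = a + b * x ∧ f x ≠ 0 ∧ φ x = (c + d * x) / (a + b * x)) ∨
            (0 < γ ∧ ∀ x ∈ I,
              f x = a * Real.sinh (Real.sqrt γ * x) + b * Real.cosh (Real.sqrt γ * x) ∧
              f x ≠ 0 ∧
              φ x = (c * Real.sinh (Real.sqrt γ * x) + d * Real.cosh (Real.sqrt γ * x)) /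
                (a * Real.sinh (Real.sqrt γ * x) + b * Real.cosh (Real.sqrt γ * x)))))) := by
  constructor
  · intro h
    rcases SolvesMidpointEq.const_or_combination h hIopen hIconn hφ with ⟨c, hc⟩ | ⟨γ, hγ⟩
    · exact Or.inl
        (SolvesMidpointEq.exists_ordConnected_support h hIopen hIconn hφ hc)
    right
    have quot : ∀ {x F G : ℝ}, f x ≠ 0 → f x = F → φ x * f x = G → φ x = G / F :=
      fun h₀ h₁ h₂ => by rw [← h₁, ← h₂, mul_div_cancel_right₀ _ h₀]
    rcases lt_trichotomy γ 0 with hneg | rfl | hpos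
    · have hw : √(-γ) ≠ 0 := (Real.sqrt_pos.2 (neg_pos.2 hneg)).ne'
      have hsq : -√(-γ) ^ 2 = γ := by rw [Real.sq_sqrt (neg_pos.2 hneg).le, neg_neg]
      obtain ⟨a, b, c, d, hdet, hx⟩ := hγ _ _ (hsq ▸ isSinCosPair_sin hw)
      refine ⟨a / √(-γ), b, c / √(-γ), d, γ, fun e => hdet ?_, Or.inl ⟨hneg, fun x hxI => ?_⟩⟩
      · field_simp at e
        exact e
      · obtain ⟨h₀, h₁, h₂⟩ := hx x hxI
        rw [mul_div_assoc', mul_div_right_comm] at h₁ h₂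
        exact ⟨h₁, h₀, quot h₀ h₁ h₂⟩
    · obtain ⟨a, b, c, d, hdet, hx⟩ := hγ _ _ isSinCosPair_id
      refine ⟨b, a, d, c, 0, fun e => hdet (by linear_combination -e),
        Or.inr (Or.inl ⟨rfl, fun x hxI => ?_⟩)⟩
      obtain ⟨h₀, h₁, h₂⟩ := hx x hxI
      rw [mul_one, add_comm] at h₁ h₂
      exact ⟨h₁, h₀, quot h₀ h₁ h₂⟩
    · have hw : √γ ≠ 0 := (Real.sqrt_pos.2 hpos).ne'
      have hsq : √γ ^ 2 = γ := Real.sq_sqrt hpos.le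
      obtain ⟨a, b, c, d, hdet, hx⟩ := hγ _ _ (hsq ▸ isSinCosPair_sinh hw)
      refine ⟨a / √γ, b, c / √γ, d, γ, fun e => hdet ?_,
        Or.inr (Or.inr ⟨hpos, fun x hxI => ?_⟩)⟩
      · field_simp at e
        exact e
      · obtain ⟨h₀, h₁, h₂⟩ := hx x hxI
        rw [mul_div_assoc', mul_div_right_comm] at h₁ h₂
        exact ⟨h₁, h₀, quot h₀ h₁ h₂⟩
  · rintro (⟨J, hJI, -, hf, c, hc⟩ | ⟨a, b, c, d, γ, -, ⟨-, h⟩ | ⟨-, h⟩ | ⟨-, h⟩⟩)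
    · exact SolvesMidpointEq.of_ordConnected_support hf hJI hc
    · have key : ∀ p q m t : ℝ,
          (p * Real.sin (√(-γ) * (m + t)) + q * Real.cos (√(-γ) * (m + t))) +
            (p * Real.sin (√(-γ) * (m - t)) + q * Real.cos (√(-γ) * (m - t))) =
          2 * Real.cos (√(-γ) * t) * (p * Real.sin (√(-γ) * m) + q * Real.cos (√(-γ) * m)) := by
        intro p q m t
        rw [mul_add, mul_sub, Real.sin_add, Real.sin_sub, Real.cos_add, Real.cos_sub]
        ring
      exact SolvesMidpointEq.of_quotient hIconn (key a b) (key c d) h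
    · have key : ∀ p q m t : ℝ, (p + q * (m + t)) + (p + q * (m - t)) = 2 * 1 * (p + q * m) := by
        intro p q m t
        ring
      exact SolvesMidpointEq.of_quotient (κ := fun _ => 1) hIconn (key a b) (key c d) h
    · have key : ∀ p q m t : ℝ,
          (p * Real.sinh (√γ * (m + t)) + q * Real.cosh (√γ * (m + t))) +
            (p * Real.sinh (√γ * (m - t)) + q * Real.cosh (√γ * (m - t))) =
          2 * Real.cosh (√γ * t) * (p * Real.sinh (√γ * m) + q * Real.cosh (√γ * m)) := by
        intro p q m t
        rw [mul_add, mul_sub, Real.sinh_add, Real.sinh_sub, Real.cosh_add, Real.cosh_sub]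
        ring
      exact SolvesMidpointEq.of_quotient hIconn (key a b) (key c d) h
end
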